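/- Assume that d_A(A) = {0} or that every κ ∈ Sym²(k)^k for which Γ(κ) is a 3-coboundary satisfies Γ(κ) = 0. Then every 2-cocycle f = f₁∘p₁ + f₂∘p₂ + f₃∘p₃ on g with values in a K-vector space z is a sum f = f₁⁰∘p₁ + f₁¹∘p₁ + f₂∘p₂ + f₃∘p₃ of four 2-cocycles, where (a) f₁⁰∘p₁ vanishes on g × g'; (b) im(f̃₁¹) ⊆ Sym²(k,z)^k and f̃₁¹ is a cyclic 1-cocycle, i.e. f̃₁¹(a,bc) + f̃₁¹(b,ca) + f̃₁¹(c,ab) = 0 for all a,b,c ∈ A; (c) f̃₂(a) ∈ Z²(k,z) for all a ∈ A; (d) f₃∘p₃ vanishes on g × g'. -/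

import Mathlib

set_option linter.unusedSectionVars false
set_option synthInstance.maxHeartbeats 1000000
set_option maxHeartbeats 1000000
open scoped TensorProduct

namespace CurrentPaper

variable (K : Type*) [Field K] [CharZero K]

section Wedge

variable (V : Type*) [AddCommGroup V] [Module K V]

/-- `x ∧ y = (1/2)(x ⊗ y - y ⊗ x)` inside `V ⊗ V`. -/
noncomputable def wedge (x y : V) : V ⊗[K] V := (2 : K)⁻¹ • (x ⊗ₜ[K] y - y ⊗ₜ[K] x)

/-- `x ∨ y = (1/2)(x ⊗ y + y ⊗ x)` inside `V ⊗ V`. -/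
noncomputable def vee (x y : V) : V ⊗[K] V := (2 : K)⁻¹ • (x ⊗ₜ[K] y + y ⊗ₜ[K] x)

/-- `Λ²(V)` realized as the subspace of skew-symmetric tensors of `V ⊗ V`. -/
def lambda2 : Submodule K (V ⊗[K] V) := Submodule.span K {t | ∃ x y : V, t = wedge K V x y}

/-- `S²(V)` realized as the subspace of symmetric tensors of `V ⊗ V`. -/
def sym2 : Submodule K (V ⊗[K] V) := Submodule.span K {t | ∃ x y : V, t = vee K V x y}

variable {V}

lemma wedge_mem (x y : V) : wedge K V x y ∈ lambda2 K V := Submodule.subset_span ⟨x, y, rfl⟩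

lemma vee_mem (x y : V) : vee K V x y ∈ sym2 K V := Submodule.subset_span ⟨x, y, rfl⟩

end Wedge

section LieRelaxed

variable (L : Type*) [LieRing L] [Module K L]

/-- `∂(u ∧ v ∧ w) = ⁅u,v⁆ ∧ w + ⁅v,w⁆ ∧ u + ⁅w,u⁆ ∧ v`. -/
noncomputable def dd (u v w : L) : L ⊗[K] L :=
  wedge K L ⁅u, v⁆ w + wedge K L ⁅v, w⁆ u + wedge K L ⁅w, u⁆ v

/-- `B₂(L)`, the space of 2-boundaries, i.e. the image of `∂ : Λ³(L) → Λ²(L)`. -/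
def B2 : Submodule K (L ⊗[K] L) := Submodule.span K {t | ∃ u v w : L, t = dd K L u v w}

variable {L}

lemma dd_mem_lambda2 (u v w : L) : dd K L u v w ∈ lambda2 K L :=
  add_mem (add_mem (wedge_mem K _ _) (wedge_mem K _ _)) (wedge_mem K _ _)

lemma dd_mem_B2 (u v w : L) : dd K L u v w ∈ B2 K L := Submodule.subset_span ⟨u, v, w, rfl⟩

end LieRelaxed

section Lie

variable (L : Type*) [LieRing L] [LieAlgebra K L]

/-- The bracket `b : L ⊗ L → L`, `u ⊗ v ↦ ⁅u,v⁆`, as a linear map. -/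
noncomputable def bracketHom : L ⊗[K] L →ₗ[K] L :=
  TensorProduct.lift (LinearMap.mk₂ K (fun u v => ⁅u, v⁆) add_lie smul_lie lie_add lie_smul)

/-- `Z₂(L) = Λ²(L) ∩ ker b`, the space of 2-cycles. -/
noncomputable def Z2 : Submodule K (L ⊗[K] L) := lambda2 K L ⊓ LinearMap.ker (bracketHom K L)

/-- The derived algebra `L' = [L,L]`, as a subspace of `L`. -/
def derived : Submodule K L := Submodule.span K {m | ∃ u v : L, m = ⁅u, v⁆}

end Lie

section Alg

variable (A : Type*) [CommRing A] [Algebra K A]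

/-- `I_A ⊆ S²(A)`: the kernel of the multiplication map `S²(A) → A`. -/
noncomputable def ia : Submodule K (A ⊗[K] A) := sym2 K A ⊓ LinearMap.ker (LinearMap.mul' K A)

/-- `T(A) ⊆ Λ²(A)`: the span of the elements `ab ∧ c + bc ∧ a + ca ∧ b`. -/
def TA : Submodule K (A ⊗[K] A) :=
  Submodule.span K
    {t | ∃ a b c : A, t = wedge K A (a*b) c + wedge K A (b*c) a + wedge K A (c*a) b}

/-- `T₀(A) ⊆ Λ²(A)`: the span of the elements `ab ∧ c + bc ∧ a + ca ∧ b - abc ∧ 1`. -/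
def T0A : Submodule K (A ⊗[K] A) :=
  Submodule.span K
    {t | ∃ a b c : A,
      t = wedge K A (a*b) c + wedge K A (b*c) a + wedge K A (c*a) b - wedge K A (a*b*c) 1}

variable {A}

lemma TA_el_mem_lambda2 (a b c : A) :
    wedge K A (a*b) c + wedge K A (b*c) a + wedge K A (c*a) b ∈ lambda2 K A :=
  add_mem (add_mem (wedge_mem K _ _) (wedge_mem K _ _)) (wedge_mem K _ _)

lemma T0A_el_mem_lambda2 (a b c : A) :
    wedge K A (a*b) c + wedge K A (b*c) a + wedge K A (c*a) b - wedge K A (a*b*c) 1 ∈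
      lambda2 K A :=
  sub_mem (TA_el_mem_lambda2 K a b c) (wedge_mem K _ _)

lemma ia_el_mem (a b : A) : vee K A a b - vee K A (a * b) 1 ∈ ia K A := by
  refine Submodule.mem_inf.mpr ⟨sub_mem (vee_mem K a b) (vee_mem K _ _), ?_⟩
  simp only [LinearMap.mem_ker, map_sub, vee, map_smul, map_add, LinearMap.mul'_apply,
    mul_one, one_mul, mul_comm b a]
  simp

end Alg

section Current

variable (A : Type*) [CommRing A] [Algebra K A]
variable (k : Type*) [LieRing k] [LieAlgebra K k]

lemma g_smul_lie (c : K) (x y : A ⊗[K] k) : ⁅c • x, y⁆ = c • ⁅x, y⁆ := by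
  rw [← algebraMap_smul A c x, ← algebraMap_smul A c ⁅x, y⁆, smul_lie]

lemma g_lie_smul (c : K) (x y : A ⊗[K] k) : ⁅x, c • y⁆ = c • ⁅x, y⁆ := by
  rw [← algebraMap_smul A c y, ← algebraMap_smul A c ⁅x, y⁆, lie_smul]

/-- The bracket of the current algebra `g = A ⊗ k`, as a `K`-linear map `g ⊗ g → g`. -/
noncomputable def gBracket : (A ⊗[K] k) ⊗[K] (A ⊗[K] k) →ₗ[K] A ⊗[K] k :=
  TensorProduct.lift (LinearMap.mk₂ K (fun u v => ⁅u, v⁆) add_lie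
    (fun c x y => g_smul_lie K A k c x y) lie_add (fun c x y => g_lie_smul K A k c x y))

/-- `Z₂(g) = Λ²(g) ∩ ker b` for the current algebra `g = A ⊗ k`. -/
noncomputable def Z2g : Submodule K ((A ⊗[K] k) ⊗[K] (A ⊗[K] k)) :=
  lambda2 K (A ⊗[K] k) ⊓ LinearMap.ker (gBracket K A k)

/-- The first summand `Λ²(A) ⊗ S²(k)` of the decomposition of `Λ²(A ⊗ k)`. -/
abbrev M1 := (↥(lambda2 K A)) ⊗[K] (↥(sym2 K k))

/-- The second summand `A ⊗ Λ²(k)` of the decomposition of `Λ²(A ⊗ k)`. -/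
abbrev M2 := A ⊗[K] (↥(lambda2 K k))

/-- The third summand `I_A ⊗ Λ²(k)` of the decomposition of `Λ²(A ⊗ k)`. -/
abbrev M3 := (↥(ia K A)) ⊗[K] (↥(lambda2 K k))

/-- The target of the isomorphism `P = (p₁,p₂,p₃)`. -/
abbrev Wspace := M1 K A k × M2 K A k × M3 K A k

variable {A k}

/-- The property characterizing the linear isomorphism
`P = (p₁,p₂,p₃) : Λ²(A ⊗ k) ≅ (Λ²(A) ⊗ S²(k)) ⊕ (A ⊗ Λ²(k)) ⊕ (I_A ⊗ Λ²(k))`: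
`p₁(ax ∧ by) = a ∧ b ⊗ x ∨ y`, `p₂(ax ∧ by) = ab ⊗ x ∧ y`,
`p₃(ax ∧ by) = (a ∨ b - ab ∨ 1) ⊗ x ∧ y`. -/
def IsDecomposition (P : ↥(lambda2 K (A ⊗[K] k)) ≃ₗ[K] Wspace K A k) : Prop :=
  ∀ (a b : A) (x y : k),
    P ⟨wedge K (A ⊗[K] k) (a ⊗ₜ x) (b ⊗ₜ y), wedge_mem K _ _⟩ =
      ((⟨wedge K A a b, wedge_mem K a b⟩ ⊗ₜ[K] ⟨vee K k x y, vee_mem K x y⟩ : M1 K A k),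
       ((a * b) ⊗ₜ[K] ⟨wedge K k x y, wedge_mem K x y⟩ : M2 K A k),
       ((⟨vee K A a b - vee K A (a * b) 1, ia_el_mem K a b⟩ ⊗ₜ[K]
          ⟨wedge K k x y, wedge_mem K x y⟩ : M3 K A k)))

end Current

end CurrentPaper

namespace CurrentPaper

variable (K : Type*) [Field K] [CharZero K]
variable (A : Type*) [CommRing A] [Algebra K A]
variable (k : Type*) [LieRing k] [LieAlgebra K k]
variable (z : Type*) [AddCommGroup z] [Module K z]

/-- A `z`-valued linear map on `Λ²(g)` is a 2-cocycle iff it vanishes on `B₂(g)`. -/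
def IsCocycle (F : ↥(lambda2 K (A ⊗[K] k)) → z) : Prop :=
  ∀ t : ↥(lambda2 K (A ⊗[K] k)),
    (t : (A ⊗[K] k) ⊗[K] (A ⊗[K] k)) ∈ B2 K (A ⊗[K] k) → F t = 0

end CurrentPaper

namespace CurrentPaper

section Bilinear

variable (K : Type*) [Field K] [CharZero K]
variable (V : Type*) [AddCommGroup V] [Module K V]

/-- The alternating bilinear map `(x, y) ↦ x ∧ y` with values in `Λ²(V)`. -/
noncomputable def wedgeHom : V →ₗ[K] V →ₗ[K] ↥(lambda2 K V) :=
  LinearMap.mk₂ K (fun x y => ⟨wedge K V x y, wedge_mem K x y⟩)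
    (fun x x' y => Subtype.ext <| by
      simp only [wedge, Submodule.coe_add, TensorProduct.add_tmul, TensorProduct.tmul_add]; module)
    (fun c x y => Subtype.ext <| by
      simp only [wedge, Submodule.coe_smul, TensorProduct.tmul_smul, ← TensorProduct.smul_tmul']
      module)
    (fun x y y' => Subtype.ext <| by
      simp only [wedge, Submodule.coe_add, TensorProduct.add_tmul, TensorProduct.tmul_add]; module)
    (fun c x y => Subtype.ext <| by
      simp only [wedge, Submodule.coe_smul, TensorProduct.tmul_smul, ← TensorProduct.smul_tmul']
      module)

/-- The symmetric bilinear map `(x, y) ↦ x ∨ y` with values in `S²(V)`. -/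
noncomputable def veeHom : V →ₗ[K] V →ₗ[K] ↥(sym2 K V) :=
  LinearMap.mk₂ K (fun x y => ⟨vee K V x y, vee_mem K x y⟩)
    (fun x x' y => Subtype.ext <| by
      simp only [vee, Submodule.coe_add, TensorProduct.add_tmul, TensorProduct.tmul_add]; module)
    (fun c x y => Subtype.ext <| by
      simp only [vee, Submodule.coe_smul, TensorProduct.tmul_smul, ← TensorProduct.smul_tmul']
      module)
    (fun x y y' => Subtype.ext <| by
      simp only [vee, Submodule.coe_add, TensorProduct.add_tmul, TensorProduct.tmul_add]; module)
    (fun c x y => Subtype.ext <| by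
      simp only [vee, Submodule.coe_smul, TensorProduct.tmul_smul, ← TensorProduct.smul_tmul']
      module)

variable {V}

lemma wedgeHom_swap (x y : V) : wedgeHom K V x y = -wedgeHom K V y x :=
  Subtype.ext <| by
    change wedge K V x y = -wedge K V y x
    simp only [wedge]; module

lemma veeHom_comm (x y : V) : veeHom K V x y = veeHom K V y x :=
  Subtype.ext <| by
    change vee K V x y = vee K V y x
    simp only [vee]; module

end Bilinear

section IA

variable (K : Type*) [Field K] [CharZero K]
variable (A : Type*) [CommRing A] [Algebra K A]

/-- The element `a ∨ b - ab ∨ 1` of `I_A`. -/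
noncomputable def iaEl (a b : A) : ↥(ia K A) :=
  ⟨vee K A a b - vee K A (a * b) 1, ia_el_mem K a b⟩

variable {A}

lemma iaEl_comm (a b : A) : iaEl K A a b = iaEl K A b a :=
  Subtype.ext <| by
    change vee K A a b - vee K A (a * b) 1 = vee K A b a - vee K A (b * a) 1
    rw [mul_comm b a]
    simp only [vee]; module

lemma iaEl_one (a : A) : iaEl K A a 1 = 0 :=
  Subtype.ext <| by
    change vee K A a 1 - vee K A (a * 1) 1 = 0
    rw [mul_one, sub_self]

lemma mem_span_iaEl (t : ↥(ia K A)) :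
    t ∈ Submodule.span K {t | ∃ a b : A, t = iaEl K A a b} := by
  let r : A ⊗[K] A →ₗ[K] A ⊗[K] A :=
    LinearMap.id - (sym2 K A).subtype ∘ₗ (veeHom K A).flip 1 ∘ₗ LinearMap.mul' K A
  have hr : sym2 K A ≤
      ((Submodule.span K {t | ∃ a b : A, t = iaEl K A a b}).map (ia K A).subtype).comap r := by
    refine Submodule.span_le.mpr ?_
    rintro _ ⟨a, b, rfl⟩
    refine ⟨iaEl K A a b, Submodule.subset_span ⟨a, b, rfl⟩, ?_⟩
    have hmul : LinearMap.mul' K A (vee K A a b) = a * b := by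
      rw [vee, map_smul, map_add, LinearMap.mul'_apply, LinearMap.mul'_apply, mul_comm b a,
        ← two_smul K, smul_smul, inv_mul_cancel₀ two_ne_zero, one_smul]
    change vee K A a b - vee K A (a * b) 1 =
      vee K A a b - vee K A (LinearMap.mul' K A (vee K A a b)) 1
    rw [hmul]
  obtain ⟨ht, hker⟩ := Submodule.mem_inf.mp t.2
  obtain ⟨s, hs, hst⟩ := hr ht
  have hrt : r t = t := by
    simp only [r, LinearMap.sub_apply, LinearMap.comp_apply, LinearMap.mem_ker.mp hker, map_zero,
      LinearMap.id_apply, sub_zero]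
  rwa [← Subtype.ext (hst.trans hrt)]

end IA

section Cocycle

variable (K : Type*) [Field K] [CharZero K]
variable (A : Type*) [CommRing A] [Algebra K A]
variable (k : Type*) [LieRing k] [LieAlgebra K k]
variable (z : Type*) [AddCommGroup z] [Module K z]

lemma isCocycle_iff (F : ↥(lambda2 K (A ⊗[K] k)) →ₗ[K] z) :
    IsCocycle K A k z F ↔ ∀ (a b c : A) (x y w : k),
      F (wedgeHom K _ ((a * b) ⊗ₜ ⁅x, y⁆) (c ⊗ₜ w)) +
        F (wedgeHom K _ ((b * c) ⊗ₜ ⁅y, w⁆) (a ⊗ₜ x)) +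
        F (wedgeHom K _ ((c * a) ⊗ₜ ⁅w, x⁆) (b ⊗ₜ y)) = 0 := by
  constructor
  · intro h a b c x y w
    have := h ⟨_, dd_mem_lambda2 K (a ⊗ₜ[K] x) (b ⊗ₜ[K] y) (c ⊗ₜ[K] w)⟩ (dd_mem_B2 K _ _ _)
    rw [← map_add, ← map_add, ← this]
    congr 1
  · intro h
    have key : ∀ u v w : A ⊗[K] k,
        F (wedgeHom K _ ⁅u, v⁆ w) + F (wedgeHom K _ ⁅v, w⁆ u) + F (wedgeHom K _ ⁅w, u⁆ v) = 0 := by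
      have add_zero_sum : ∀ p q r p' q' r' : z, p + q + r = 0 → p' + q' + r' = 0 →
          (p + p') + (q + q') + (r + r') = 0 := by
        intro p q r p' q' r' h h'
        rw [show (p + p') + (q + q') + (r + r') = (p + q + r) + (p' + q' + r') by abel, h, h',
          add_zero]
      intro u v w
      induction u using TensorProduct.induction_on with
      | zero => simp
      | add u u' hu hu' =>
        simp only [add_lie, lie_add, map_add, LinearMap.add_apply]
        exact add_zero_sum _ _ _ _ _ _ hu hu'
      | tmul a x =>
      induction v using TensorProduct.induction_on with
      | zero => simp
      | add u u' hu hu' =>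
        simp only [add_lie, lie_add, map_add, LinearMap.add_apply]
        exact add_zero_sum _ _ _ _ _ _ hu hu'
      | tmul b y =>
      induction w using TensorProduct.induction_on with
      | zero => simp
      | add u u' hu hu' =>
        simp only [add_lie, lie_add, map_add, LinearMap.add_apply]
        exact add_zero_sum _ _ _ _ _ _ hu hu'
      | tmul c w =>
        simpa only [LieAlgebra.ExtendScalars.bracket_tmul] using h a b c x y w
    have hle : B2 K (A ⊗[K] k) ≤ (LinearMap.ker F).map (lambda2 K (A ⊗[K] k)).subtype := by
      refine Submodule.span_le.mpr ?_
      rintro _ ⟨u, v, w, rfl⟩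
      refine ⟨wedgeHom K _ ⁅u, v⁆ w + wedgeHom K _ ⁅v, w⁆ u + wedgeHom K _ ⁅w, u⁆ v, ?_, rfl⟩
      simpa using key u v w
    intro t ht
    obtain ⟨s, hs, hst⟩ := hle ht
    rw [← Subtype.ext hst]
    exact hs

end Cocycle

section Derivation

variable {K : Type*} [Field K] [CharZero K]
variable {A : Type*} [CommRing A] [Algebra K A]
variable {z : Type*} [AddCommGroup z] [Module K z]

/-- The `A`-module structure `(a • φ) c = φ (a c)` on `Hom_K(A, z)`. -/
abbrev homModule : Module A (A →ₗ[K] z) where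
  smul a φ := φ ∘ₗ LinearMap.mulLeft K a
  one_smul φ := LinearMap.ext fun c => congrArg φ (one_mul c)
  mul_smul a b φ := LinearMap.ext fun c => congrArg φ (by
    change a * b * c = b * (a * c); ring)
  smul_zero a := rfl
  smul_add a φ ψ := rfl
  add_smul a b φ := LinearMap.ext fun c => (congrArg φ (add_mul a b c)).trans (map_add φ _ _)
  zero_smul φ := LinearMap.ext fun c => (congrArg φ (zero_mul c)).trans (map_zero φ)

/-- A bilinear map satisfying the Leibniz rule `h(bc)(a) = h(b)(ca) + h(c)(ba)` factors through
the universal derivation. -/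
lemma eq_zero_of_leibniz (hD : ∀ a : A, KaehlerDifferential.D K A a = 0)
    (h : A →ₗ[K] A →ₗ[K] z) (hL : ∀ a b c : A, h (b * c) a = h b (c * a) + h c (b * a))
    (b : A) : h b = 0 := by
  let _ : Module A (A →ₗ[K] z) := homModule
  have : IsScalarTower K A (A →ₗ[K] z) := ⟨fun r a φ => LinearMap.ext fun c => by
    change φ ((r • a) * c) = r • φ (a * c)
    rw [smul_mul_assoc, map_smul]⟩
  let δ : Derivation K A (A →ₗ[K] z) := Derivation.mk' h fun b c => LinearMap.ext fun a => by
    rw [hL a b c, add_comm]; rfl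
  have : δ b = δ.liftKaehlerDifferential (KaehlerDifferential.D K A b) :=
    (δ.liftKaehlerDifferential_comp_D b).symm
  rw [hD, map_zero] at this
  exact this

/-- If `d_A = 0`, an alternating map on `A` that vanishes on `T₀(A)` vanishes on `A ∧ 1`. -/
lemma apply_one_eq_zero_of_D_eq_zero (hD : ∀ a : A, KaehlerDifferential.D K A a = 0)
    (H : A →ₗ[K] A →ₗ[K] z) (halt : ∀ a b : A, H a b = -H b a)
    (hT : ∀ a b c : A, H (a * b) c + H (b * c) a + H (c * a) b = H (a * b * c) 1) (b : A) :
    H b 1 = 0 := by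
  have h2 : (2 : K) ≠ 0 := two_ne_zero
  have := eq_zero_of_leibniz hD (H + (LinearMap.mul K A).compr₂ (H.flip 1)) (fun a b c => by
    have e := hT a b c
    have e1 := halt (a * b) c
    have e2 := halt (c * a) b
    simp only [LinearMap.add_apply, LinearMap.compr₂_apply, LinearMap.mul_apply',
      LinearMap.flip_apply]
    rw [e1, e2] at e
    rw [show b * (c * a) = a * b * c by ring, show c * (b * a) = a * b * c by ring,
      show b * c * a = a * b * c by ring, ← e, mul_comm b a]
    abel) b
  have := LinearMap.congr_fun this 1
  simp only [LinearMap.add_apply, LinearMap.compr₂_apply, LinearMap.mul_apply',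
      LinearMap.flip_apply, mul_one, LinearMap.zero_apply, ← two_smul K] at this
  exact (smul_eq_zero.mp this).resolve_left h2

end Derivation

section Derived

variable {K : Type*} [Field K] [CharZero K]
variable {k : Type*} [LieRing k] [LieAlgebra K k]
variable {z : Type*} [AddCommGroup z] [Module K z]

lemma apply_eq_zero_of_mem_derived (β : k →ₗ[K] z) (h : ∀ x y : k, β ⁅x, y⁆ = 0) {y : k}
    (hy : y ∈ derived K k) : β y = 0 := by
  have hle : derived K k ≤ LinearMap.ker β := by
    refine Submodule.span_le.mpr ?_
    rintro _ ⟨u, v, rfl⟩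
    exact h u v
  exact hle hy

/-- If a `z`-valued invariant symmetric form `κ` has `Γ(κ) = dη`, then `Γ(κ) = 0` as soon as this
implication holds for scalar-valued forms. -/
lemma koszul_eq_zero_of_scalar
    (hyp : ∀ κ : k →ₗ[K] k →ₗ[K] K, (∀ x y : k, κ x y = κ y x) →
        (∀ x y w : k, κ ⁅x, y⁆ w = κ x ⁅y, w⁆) →
        (∃ η : k →ₗ[K] k →ₗ[K] K, (∀ x : k, η x x = 0) ∧
          ∀ x y w : k, κ ⁅x, y⁆ w = -(η ⁅x, y⁆ w) - η ⁅y, w⁆ x - η ⁅w, x⁆ y) →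
        ∀ x y w : k, κ ⁅x, y⁆ w = 0)
    (κ η : k →ₗ[K] k →ₗ[K] z) (hsymm : ∀ x y : k, κ x y = κ y x)
    (hinv : ∀ x y w : k, κ ⁅x, y⁆ w = κ x ⁅y, w⁆) (halt : ∀ x : k, η x x = 0)
    (hcob : ∀ x y w : k, κ ⁅x, y⁆ w = -(η ⁅x, y⁆ w) - η ⁅y, w⁆ x - η ⁅w, x⁆ y) (x y w : k) :
    κ ⁅x, y⁆ w = 0 := by
  rw [← Module.forall_dual_apply_eq_zero_iff K]
  intro φ
  refine hyp (κ.compr₂ φ) (fun x y => congrArg φ (hsymm x y))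
    (fun x y w => congrArg φ (hinv x y w)) ⟨η.compr₂ φ, fun x => ?_, fun x y w => ?_⟩ x y w
  · rw [LinearMap.compr₂_apply, halt, map_zero]
  · simp only [LinearMap.compr₂_apply, hcob, map_sub, map_neg]

end Derived

section Relations

variable {K : Type*} [Field K] [CharZero K]
variable {A : Type*} [CommRing A] [Algebra K A]
variable {k : Type*} [LieRing k] [LieAlgebra K k]
variable {z : Type*} [AddCommGroup z] [Module K z]

/-- The relations between the components of a 2-cocycle `f₁∘p₁ + f₂∘p₂ + f₃∘p₃`. -/
lemma cocycle_relations (f1 : M1 K A k →ₗ[K] z) (f2 : M2 K A k →ₗ[K] z) (f3 : M3 K A k →ₗ[K] z)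
    (h : ∀ (a b c : A) (x y w : k),
      (f1 (wedgeHom K A (a * b) c ⊗ₜ veeHom K k ⁅x, y⁆ w) +
        f1 (wedgeHom K A (b * c) a ⊗ₜ veeHom K k ⁅y, w⁆ x) +
        f1 (wedgeHom K A (c * a) b ⊗ₜ veeHom K k ⁅w, x⁆ y)) +
      f2 ((a * b * c) ⊗ₜ (wedgeHom K k ⁅x, y⁆ w + wedgeHom K k ⁅y, w⁆ x + wedgeHom K k ⁅w, x⁆ y)) +
      (f3 (iaEl K A (a * b) c ⊗ₜ wedgeHom K k ⁅x, y⁆ w) +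
        f3 (iaEl K A (b * c) a ⊗ₜ wedgeHom K k ⁅y, w⁆ x) +
        f3 (iaEl K A (c * a) b ⊗ₜ wedgeHom K k ⁅w, x⁆ y)) = 0) :
    (∀ (a b : A) (x y w : k), f1 (wedgeHom K A a b ⊗ₜ veeHom K k ⁅x, y⁆ w) =
      f1 (wedgeHom K A a b ⊗ₜ veeHom K k ⁅y, w⁆ x)) ∧
    (∀ (a b : A) (x y w : k), f3 (iaEl K A a b ⊗ₜ wedgeHom K k ⁅x, y⁆ w) = 0) ∧
    (∀ (a : A) (x y w : k), f1 (wedgeHom K A a 1 ⊗ₜ veeHom K k ⁅x, y⁆ w) =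
      -f2 (a ⊗ₜ (wedgeHom K k ⁅x, y⁆ w + wedgeHom K k ⁅y, w⁆ x + wedgeHom K k ⁅w, x⁆ y))) ∧
    (∀ (a b c : A) (x y w : k),
      f1 (wedgeHom K A (a * b) c ⊗ₜ veeHom K k ⁅x, y⁆ w) +
        f1 (wedgeHom K A (b * c) a ⊗ₜ veeHom K k ⁅x, y⁆ w) +
        f1 (wedgeHom K A (c * a) b ⊗ₜ veeHom K k ⁅x, y⁆ w) =
      f1 (wedgeHom K A (a * b * c) 1 ⊗ₜ veeHom K k ⁅x, y⁆ w)) := by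
  have half : ∀ {p : z}, p + p = 0 → p = 0 := fun {p} hp => by
    rw [← two_smul K] at hp
    exact (smul_eq_zero.mp hp).resolve_left two_ne_zero
  let s (a : A) (x y w : k) : z :=
    f2 (a ⊗ₜ (wedgeHom K k ⁅x, y⁆ w + wedgeHom K k ⁅y, w⁆ x + wedgeHom K k ⁅w, x⁆ y))
  have s_cyc (a : A) (x y w : k) : s a x y w = s a y w x := by
    simp only [s]
    rw [add_assoc, add_comm]
  have swap1 (a b : A) (x y : k) : f1 (wedgeHom K A a b ⊗ₜ veeHom K k x y) =
      -f1 (wedgeHom K A b a ⊗ₜ veeHom K k x y) := by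
    let φ := f1 ∘ₗ (TensorProduct.mk K _ _).flip (veeHom K k x y)
    exact (congrArg φ (wedgeHom_swap K a b)).trans (map_neg φ _)
  have unit_rel (a : A) (x y w : k) : f1 (wedgeHom K A a 1 ⊗ₜ veeHom K k ⁅x, y⁆ w) -
      f1 (wedgeHom K A a 1 ⊗ₜ veeHom K k ⁅y, w⁆ x) +
      f1 (wedgeHom K A a 1 ⊗ₜ veeHom K k ⁅w, x⁆ y) + s a x y w = 0 := by
    have e := h a 1 1 x y w
    simp only [mul_one, one_mul, iaEl_comm K 1 a, iaEl_one, TensorProduct.zero_tmul, map_zero,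
      add_zero, swap1 1 a] at e
    rw [← e]; simp only [s]; abel
  have G_cyc (a : A) (x y w : k) : f1 (wedgeHom K A a 1 ⊗ₜ veeHom K k ⁅x, y⁆ w) =
      f1 (wedgeHom K A a 1 ⊗ₜ veeHom K k ⁅y, w⁆ x) := by
    have e1 := unit_rel a w x y
    have e2 := unit_rel a x y w
    rw [s_cyc] at e1
    generalize f1 (wedgeHom K A a 1 ⊗ₜ veeHom K k ⁅x, y⁆ w) = p at *
    generalize f1 (wedgeHom K A a 1 ⊗ₜ veeHom K k ⁅y, w⁆ x) = q at *
    generalize f1 (wedgeHom K A a 1 ⊗ₜ veeHom K k ⁅w, x⁆ y) = r at *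
    have : (q - p) + (q - p) = 0 := by
      rw [← sub_eq_zero_of_eq (e1.trans e2.symm)]; abel
    exact (sub_eq_zero.mp (half this)).symm
  have G_eq (a : A) (x y w : k) :
      f1 (wedgeHom K A a 1 ⊗ₜ veeHom K k ⁅x, y⁆ w) = -s a x y w := by
    have e := unit_rel a x y w
    rw [← G_cyc a x y w, sub_self, zero_add, G_cyc a w x y] at e
    exact eq_neg_of_add_eq_zero_left e
  have pair_rel (a b : A) (x y w : k) :
      f1 (wedgeHom K A a b ⊗ₜ veeHom K k ⁅w, x⁆ y) - f1 (wedgeHom K A a b ⊗ₜ veeHom K k ⁅y, w⁆ x) +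
      (f3 (iaEl K A a b ⊗ₜ wedgeHom K k ⁅y, w⁆ x) +
        f3 (iaEl K A a b ⊗ₜ wedgeHom K k ⁅w, x⁆ y)) = 0 := by
    have e := h a b 1 x y w
    have g := G_eq (a * b) x y w
    simp only [s] at g
    simp only [mul_one, one_mul, iaEl_comm K b a, iaEl_one, TensorProduct.zero_tmul, map_zero,
      zero_add, swap1 b a, g] at e
    rw [← e]; abel
  have f3_rel (a b : A) (x y w : k) :
      f3 (iaEl K A a b ⊗ₜ wedgeHom K k ⁅y, w⁆ x) + f3 (iaEl K A a b ⊗ₜ wedgeHom K k ⁅w, x⁆ y) = 0 := by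
    have e1 := pair_rel a b x y w
    have e2 := pair_rel b a x y w
    rw [iaEl_comm K b a, swap1 b a, swap1 b a] at e2
    apply half
    rw [← add_zero (0 : z)]
    nth_rewrite 1 [← e1]
    rw [← e2]
    abel
  have f1_cyc (a b : A) (x y w : k) : f1 (wedgeHom K A a b ⊗ₜ veeHom K k ⁅x, y⁆ w) =
      f1 (wedgeHom K A a b ⊗ₜ veeHom K k ⁅y, w⁆ x) := by
    have e := pair_rel a b y w x
    rw [f3_rel, add_zero, sub_eq_zero] at e
    rw [e, ← sub_eq_zero, ← pair_rel a b x y w, f3_rel]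
    abel
  have f3_zero (a b : A) (x y w : k) : f3 (iaEl K A a b ⊗ₜ wedgeHom K k ⁅x, y⁆ w) = 0 := by
    have e1 := f3_rel a b x y w
    have e2 := f3_rel a b y w x
    have e3 := f3_rel a b w x y
    apply half
    calc _ = (f3 (iaEl K A a b ⊗ₜ wedgeHom K k ⁅w, x⁆ y) +
            f3 (iaEl K A a b ⊗ₜ wedgeHom K k ⁅x, y⁆ w)) +
          (f3 (iaEl K A a b ⊗ₜ wedgeHom K k ⁅x, y⁆ w) +
            f3 (iaEl K A a b ⊗ₜ wedgeHom K k ⁅y, w⁆ x)) -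
          (f3 (iaEl K A a b ⊗ₜ wedgeHom K k ⁅y, w⁆ x) +
            f3 (iaEl K A a b ⊗ₜ wedgeHom K k ⁅w, x⁆ y)) := by abel
      _ = 0 := by rw [e1, e2, e3, add_zero, sub_zero]
  refine ⟨f1_cyc, f3_zero, G_eq, fun a b c x y w => ?_⟩
  have e := h a b c x y w
  rw [f3_zero, f3_zero, f3_zero, ← f1_cyc (b * c) a, f1_cyc (c * a) b, add_zero, add_zero,
    add_zero] at e
  rw [G_eq]
  exact eq_neg_of_add_eq_zero_left e

end Relations

variable (K : Type*) [Field K] [CharZero K]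
variable (A : Type*) [CommRing A] [Algebra K A]
variable (k : Type*) [LieRing k] [LieAlgebra K k]
variable (z : Type*) [AddCommGroup z] [Module K z]

/-- If `d_A(A) = {0}`, or every invariant symmetric bilinear form `κ`
on `k` for which `Γ(κ)` is a coboundary satisfies `Γ(κ) = 0`, then every 2-cocycle
`f = f₁∘p₁ + f₂∘p₂ + f₃∘p₃` is a sum `f₁⁰∘p₁ + f₁¹∘p₁ + f₂∘p₂ + f₃∘p₃` of four
2-cocycles, where (a) `f₁⁰∘p₁` vanishes on `g × g'`, (b) `f̃₁¹` has invariant values and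
is a cyclic 1-cocycle, (c) `f̃₂(A) ⊆ Z²(k,z)`, and (d) `f₃∘p₃` vanishes on `g × g'`. -/
theorem statement13
    (P : ↥(lambda2 K (A ⊗[K] k)) ≃ₗ[K] Wspace K A k) (hP : IsDecomposition K P)
    (hyp : (∀ a : A, KaehlerDifferential.D K A a = 0) ∨
      (∀ κ : k →ₗ[K] k →ₗ[K] K, (∀ x y : k, κ x y = κ y x) →
        (∀ x y w : k, κ ⁅x, y⁆ w = κ x ⁅y, w⁆) →
        (∃ η : k →ₗ[K] k →ₗ[K] K, (∀ x : k, η x x = 0) ∧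
          ∀ x y w : k, κ ⁅x, y⁆ w = -(η ⁅x, y⁆ w) - η ⁅y, w⁆ x - η ⁅w, x⁆ y) →
        ∀ x y w : k, κ ⁅x, y⁆ w = 0))
    (f1 : M1 K A k →ₗ[K] z) (f2 : M2 K A k →ₗ[K] z) (f3 : M3 K A k →ₗ[K] z)
    (hf : IsCocycle K A k z (fun t => f1 (P t).1 + f2 (P t).2.1 + f3 (P t).2.2)) :
    ∃ f10 f11 : M1 K A k →ₗ[K] z,
      f1 = f10 + f11 ∧
      IsCocycle K A k z (fun t => f10 (P t).1) ∧
      IsCocycle K A k z (fun t => f11 (P t).1) ∧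
      IsCocycle K A k z (fun t => f2 (P t).2.1) ∧
      IsCocycle K A k z (fun t => f3 (P t).2.2) ∧
      (∀ (a b : A) (x y : k), y ∈ derived K k →
        f10 (⟨wedge K A a b, wedge_mem K a b⟩ ⊗ₜ[K] ⟨vee K k x y, vee_mem K x y⟩) = 0) ∧
      (∀ (a b : A) (x y w : k),
        f11 (⟨wedge K A a b, wedge_mem K a b⟩ ⊗ₜ[K] ⟨vee K k ⁅x, y⁆ w, vee_mem K _ _⟩) =
          f11 (⟨wedge K A a b, wedge_mem K a b⟩ ⊗ₜ[K] ⟨vee K k x ⁅y, w⁆, vee_mem K _ _⟩)) ∧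
      (∀ (a b c : A) (x y : k),
        f11 (⟨wedge K A a (b*c), wedge_mem K _ _⟩ ⊗ₜ[K] ⟨vee K k x y, vee_mem K x y⟩) +
          f11 (⟨wedge K A b (c*a), wedge_mem K _ _⟩ ⊗ₜ[K] ⟨vee K k x y, vee_mem K x y⟩) +
          f11 (⟨wedge K A c (a*b), wedge_mem K _ _⟩ ⊗ₜ[K] ⟨vee K k x y, vee_mem K x y⟩) = 0) ∧
      (∀ (a : A) (x y w : k), f2 (a ⊗ₜ[K] ⟨dd K k x y w, dd_mem_lambda2 K x y w⟩) = 0) ∧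
      (∀ (c : ↥(ia K A)) (x y : k), y ∈ derived K k →
        f3 (c ⊗ₜ[K] ⟨wedge K k x y, wedge_mem K x y⟩) = 0) := by
  let F1 : ↥(lambda2 K (A ⊗[K] k)) →ₗ[K] z := f1 ∘ₗ LinearMap.fst K _ _ ∘ₗ P.toLinearMap
  let F2 : ↥(lambda2 K (A ⊗[K] k)) →ₗ[K] z :=
    f2 ∘ₗ LinearMap.fst K _ _ ∘ₗ LinearMap.snd K _ _ ∘ₗ P.toLinearMap
  let F3 : ↥(lambda2 K (A ⊗[K] k)) →ₗ[K] z :=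
    f3 ∘ₗ LinearMap.snd K _ _ ∘ₗ LinearMap.snd K _ _ ∘ₗ P.toLinearMap
  have hP1 (f : M1 K A k →ₗ[K] z) (a b : A) (x y : k) :
      f (P (wedgeHom K _ (a ⊗ₜ x) (b ⊗ₜ y))).1 = f (wedgeHom K A a b ⊗ₜ veeHom K k x y) :=
    congrArg (fun t => f t.1) (hP a b x y)
  have hP2 (a b : A) (x y : k) :
      F2 (wedgeHom K _ (a ⊗ₜ x) (b ⊗ₜ y)) = f2 ((a * b) ⊗ₜ wedgeHom K k x y) :=
    congrArg (fun t => f2 t.2.1) (hP a b x y)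
  have hP3 (a b : A) (x y : k) :
      F3 (wedgeHom K _ (a ⊗ₜ x) (b ⊗ₜ y)) = f3 (iaEl K A a b ⊗ₜ wedgeHom K k x y) :=
    congrArg (fun t => f3 t.2.2) (hP a b x y)
  obtain ⟨f1_cyc, f3_zero, G_eq, f1_T0⟩ := cocycle_relations f1 f2 f3 (fun a b c x y w => by
    have e := (isCocycle_iff K A k z (F1 + F2 + F3)).mp hf a b c x y w
    have hP1' (a b : A) (x y : k) :
      F1 (wedgeHom K _ (a ⊗ₜ x) (b ⊗ₜ y)) = f1 (wedgeHom K A a b ⊗ₜ veeHom K k x y) :=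
      hP1 f1 a b x y
    simp only [LinearMap.add_apply, hP1', hP2, hP3] at e
    rw [show b * c * a = a * b * c by ring, show c * a * b = a * b * c by ring] at e
    rw [← e, TensorProduct.tmul_add, TensorProduct.tmul_add, map_add, map_add]
    abel)
  have G_zero (a : A) (x y w : k) : f1 (wedgeHom K A a 1 ⊗ₜ veeHom K k ⁅x, y⁆ w) = 0 := by
    rcases hyp with hD | hΓ
    · exact apply_one_eq_zero_of_D_eq_zero hD
        ((wedgeHom K A).compr₂ (f1 ∘ₗ (TensorProduct.mk K _ _).flip (veeHom K k ⁅x, y⁆ w)))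
        (fun a b => by
          simp only [LinearMap.compr₂_apply]
          rw [wedgeHom_swap, map_neg])
        (fun a b c => f1_T0 a b c x y w) a
    · refine koszul_eq_zero_of_scalar hΓ
        ((veeHom K k).compr₂ (f1 ∘ₗ TensorProduct.mk K _ _ (wedgeHom K A a 1)))
        ((wedgeHom K k).compr₂ (f2 ∘ₗ TensorProduct.mk K _ _ a))
        (fun x y => by simp only [LinearMap.compr₂_apply, veeHom_comm K x y])
        (fun x y w => ?_) (fun x => ?_) (fun x y w => ?_) x y w
      · simp only [LinearMap.compr₂_apply, veeHom_comm K x ⁅y, w⁆]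
        exact f1_cyc a 1 x y w
      · have : wedgeHom K k x x = 0 := Subtype.ext (by
          change wedge K k x x = 0
          rw [wedge, sub_self, smul_zero])
        rw [LinearMap.compr₂_apply, this, map_zero]
      · refine (G_eq a x y w).trans ?_
        rw [TensorProduct.tmul_add, TensorProduct.tmul_add, map_add, map_add]
        simp only [LinearMap.compr₂_apply, LinearMap.comp_apply, TensorProduct.mk_apply]
        abel
  have f2_zero (a : A) (x y w : k) :
      f2 (a ⊗ₜ (wedgeHom K k ⁅x, y⁆ w + wedgeHom K k ⁅y, w⁆ x + wedgeHom K k ⁅w, x⁆ y)) = 0 := by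
    rw [← neg_eq_zero, ← G_eq, G_zero]
  have hF2 : IsCocycle K A k z F2 := (isCocycle_iff K A k z F2).mpr fun a b c x y w => by
    rw [hP2, hP2, hP2, show b * c * a = a * b * c by ring, show c * a * b = a * b * c by ring,
      ← map_add, ← map_add, ← TensorProduct.tmul_add, ← TensorProduct.tmul_add, f2_zero]
  have hF3 : IsCocycle K A k z F3 := (isCocycle_iff K A k z F3).mpr fun a b c x y w => by
    simp only [hP3, f3_zero, add_zero]
  let T : Submodule K ↥(lambda2 K A) := Submodule.span K
    {t | ∃ a b c : A, t = wedgeHom K A (a * b) c + wedgeHom K A (b * c) a + wedgeHom K A (c * a) b}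
  obtain ⟨ρ, hρ⟩ :=
    LinearMap.exists_leftInverse_of_injective (V := T) (V' := ↥(lambda2 K A)) T.subtype T.ker_subtype
  have f1_T (t : T) (x y w : k) : f1 ((t : ↥(lambda2 K A)) ⊗ₜ veeHom K k ⁅x, y⁆ w) = 0 := by
    have hle : T ≤ LinearMap.ker
        (f1 ∘ₗ (TensorProduct.mk K _ _).flip (veeHom K k ⁅x, y⁆ w)) := by
      refine Submodule.span_le.mpr ?_
      rintro _ ⟨a, b, c, rfl⟩
      refine LinearMap.mem_ker.mpr ?_
      rw [map_add, map_add]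
      exact (f1_T0 a b c x y w).trans (G_zero _ x y w)
    exact hle t.2
  let f10 : M1 K A k →ₗ[K] z := f1 ∘ₗ (T.subtype ∘ₗ ρ).rTensor ↥(sym2 K k)
  have f10_apply (t : ↥(lambda2 K A)) (s : ↥(sym2 K k)) :
      f10 (t ⊗ₜ s) = f1 ((ρ t : ↥(lambda2 K A)) ⊗ₜ s) := rfl
  have f10_zero (t : ↥(lambda2 K A)) (x y w : k) : f10 (t ⊗ₜ veeHom K k ⁅x, y⁆ w) = 0 :=
    f1_T (ρ t) x y w
  have hF10 : IsCocycle K A k z (fun t => f10 (P t).1) :=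
    (isCocycle_iff K A k z (f10 ∘ₗ LinearMap.fst K _ _ ∘ₗ P.toLinearMap)).mpr
      fun a b c x y w => by
        have hP10 (a b : A) (x y : k) : (f10 ∘ₗ LinearMap.fst K _ _ ∘ₗ P.toLinearMap)
            (wedgeHom K _ (a ⊗ₜ x) (b ⊗ₜ y)) = f10 (wedgeHom K A a b ⊗ₜ veeHom K k x y) :=
          hP1 f10 a b x y
        simp only [hP10, f10_zero, add_zero]
  refine ⟨f10, f1 - f10, (add_sub_cancel f10 f1).symm, hF10, fun t ht => ?_, hF2, hF3,
    fun a b x y hy => ?_, fun a b x y w => ?_, fun a b c x y => ?_, f2_zero, fun c x y hy => ?_⟩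
  · have e : f1 (P t).1 + F2 t + F3 t = 0 := hf t ht
    rw [hF2 t ht, hF3 t ht, add_zero, add_zero] at e
    have e10 : f10 (P t).1 = 0 := hF10 t ht
    exact (congrArg₂ (· - ·) e e10).trans (sub_zero 0)
  · refine apply_eq_zero_of_mem_derived
      (f10 ∘ₗ TensorProduct.mk K _ _ (wedgeHom K A a b) ∘ₗ veeHom K k x) (fun u v => ?_) hy
    change f10 (wedgeHom K A a b ⊗ₜ veeHom K k x ⁅u, v⁆) = 0
    rw [veeHom_comm, f10_zero]
  · change (f1 - f10) (wedgeHom K A a b ⊗ₜ veeHom K k ⁅x, y⁆ w) =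
      (f1 - f10) (wedgeHom K A a b ⊗ₜ veeHom K k x ⁅y, w⁆)
    rw [veeHom_comm K x, LinearMap.sub_apply, LinearMap.sub_apply, f10_zero, f10_zero, f1_cyc]
  · change (f1 - f10) (wedgeHom K A a (b * c) ⊗ₜ veeHom K k x y) +
      (f1 - f10) (wedgeHom K A b (c * a) ⊗ₜ veeHom K k x y) +
      (f1 - f10) (wedgeHom K A c (a * b) ⊗ₜ veeHom K k x y) = 0
    let t : T := ⟨wedgeHom K A (a * b) c + wedgeHom K A (b * c) a + wedgeHom K A (c * a) b,
      Submodule.subset_span ⟨a, b, c, rfl⟩⟩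
    have hsum : wedgeHom K A a (b * c) + wedgeHom K A b (c * a) + wedgeHom K A c (a * b) =
        T.subtype (-t) := by
      change _ = -(wedgeHom K A (a * b) c + wedgeHom K A (b * c) a + wedgeHom K A (c * a) b)
      rw [wedgeHom_swap K a, wedgeHom_swap K b, wedgeHom_swap K c]
      abel
    have hfix : ρ (T.subtype (-t)) = -t := LinearMap.congr_fun hρ (-t)
    rw [← map_add, ← map_add, ← TensorProduct.add_tmul, ← TensorProduct.add_tmul, hsum,
      LinearMap.sub_apply, f10_apply, hfix]
    exact sub_self _
  · refine apply_eq_zero_of_mem_derived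
      (f3 ∘ₗ TensorProduct.mk K _ _ c ∘ₗ wedgeHom K k x) (fun u v => ?_) hy
    have hle : Submodule.span K {t | ∃ a b : A, t = iaEl K A a b} ≤ LinearMap.ker
        (f3 ∘ₗ (TensorProduct.mk K _ _).flip (wedgeHom K k x ⁅u, v⁆)) := by
      refine Submodule.span_le.mpr ?_
      rintro _ ⟨a, b, rfl⟩
      change f3 (iaEl K A a b ⊗ₜ wedgeHom K k x ⁅u, v⁆) = 0
      let φ := f3 ∘ₗ TensorProduct.mk K _ _ (iaEl K A a b)
      exact (congrArg φ (wedgeHom_swap K x ⁅u, v⁆)).trans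
        ((map_neg φ _).trans (neg_eq_zero.mpr (f3_zero a b u v x)))
    exact hle (mem_span_iaEl K c)

end CurrentPaper
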